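/- Suppose X = (X_u)_{u∈V_2} is an allocation to V_2 that satisfies (P1) but does not satisfy (P2), where n ≥ 2. Then there exists another allocation X' = (X'_u)_{u∈V_2} to V_2 satisfying (P1) such that |X'_r| = |X_r| + 1. -/

import Mathlib

open Finset
open scoped Classical

noncomputable section

variable {G : Type*}

/-- Value of a bundle under an additive valuation. -/
def val (v : G → ℝ) (S : Finset G) : ℝ := ∑ g ∈ S, v g

/-- Minimum value of a good in a bundle; `0` for the empty bundle. -/
def minval (v : G → ℝ) (S : Finset G) : ℝ :=
  if h : S.Nonempty then S.inf' h v else 0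

/-- `X` is a partition of the goods into `n` pairwise disjoint (possibly empty) bundles. -/
def IsAlloc {n : ℕ} (X : Fin n → Finset G) : Prop :=
  (∀ i j : Fin n, i ≠ j → Disjoint (X i) (X j)) ∧ (∀ g : G, ∃ i : Fin n, g ∈ X i)

/-- Agent `i` is PROPavg-satisfied by the allocation `X`. -/
def PROPavgSat {n : ℕ} (v : Fin n → G → ℝ) (X : Fin n → Finset G) (i : Fin n) : Prop :=
  val (v i) (X i) + (1 / ((n : ℝ) - 1)) * ∑ k ∈ Finset.univ.erase i, minval (v i) (X k)
    ≥ 1 / (n : ℝ)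

/-- Edge of the PROPavg-graph between agent `i ∈ V₁` and label `u ∈ V₂` (both parts
are indexed by `Fin n`, `r` is the distinguished element of `V₂`). -/
def Edge {n : ℕ} (v : Fin n → G → ℝ) (X : Fin n → Finset G) (r i u : Fin n) : Prop :=
  val (v i) (X u) + (1 / ((n : ℝ) - 1)) *
      ∑ u' ∈ (Finset.univ.erase r).erase u, minval (v i) (X u')
    ≥ 1 / (n : ℝ)

/-- `i` is one of the agents `1, …, n-1`, i.e. not the last agent. -/
def InV1 {n : ℕ} (i : Fin n) : Prop := (i : ℕ) < n - 1

/-- The set `V₁` of the first `n-1` agents. -/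
def V1 (n : ℕ) : Finset (Fin n) := Finset.univ.filter fun i => (i : ℕ) < n - 1

/-- A perfect matching of `V₁` onto `V₂ \ {u}` in the PROPavg-graph `G_X`,
i.e. a bijection from `V₁` to `V₂ \ {u}` all of whose pairs are edges. -/
def IsPM {n : ℕ} (v : Fin n → G → ℝ) (X : Fin n → Finset G) (r u : Fin n)
    (f : Fin n → Fin n) : Prop :=
  Set.InjOn f {i : Fin n | InV1 i} ∧
  (∀ i : Fin n, InV1 i → f i ≠ u ∧ Edge v X r i (f i)) ∧
  (∀ w : Fin n, w ≠ u → ∃ i : Fin n, InV1 i ∧ f i = w)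

/-- Property (P1): `G_X - r` has a perfect matching. -/
def P1 {n : ℕ} (v : Fin n → G → ℝ) (X : Fin n → Finset G) (r : Fin n) : Prop :=
  ∃ f : Fin n → Fin n, IsPM v X r r f

/-- Property (P2): for every `u ∈ V₂`, `G_X - u` has a perfect matching. -/
def P2 {n : ℕ} (v : Fin n → G → ℝ) (X : Fin n → Finset G) (r : Fin n) : Prop :=
  ∀ u : Fin n, ∃ f : Fin n → Fin n, IsPM v X r u f

/-- The neighborhood `Γ_{G_X}(S) ⊆ V₂` of a set `S ⊆ V₁` in the PROPavg-graph. -/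
def Nbr {n : ℕ} (v : Fin n → G → ℝ) (X : Fin n → Finset G) (r : Fin n)
    (S : Finset (Fin n)) : Finset (Fin n) :=
  Finset.univ.filter fun u => ∃ i ∈ S, Edge v X r i u

/-- The allocation obtained from `X` by moving the good `g ∈ X ustar` to `X r`. -/
def move {n : ℕ} [DecidableEq G] (X : Fin n → Finset G) (r ustar : Fin n) (g : G) :
    Fin n → Finset G :=
  fun u => if u = r then insert g (X r) else if u = ustar then (X ustar).erase g else X u

section Minval

variable {G : Type*} {v : G → ℝ} {S T : Finset G}

lemma minval_nonneg (hv : ∀ g, 0 ≤ v g) (S : Finset G) : 0 ≤ minval v S := by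
  unfold minval
  split_ifs with h
  · exact Finset.le_inf' h v fun g _ => hv g
  · exact le_rfl

lemma minval_le_minval_of_subset (hST : S ⊆ T) (hS : S.Nonempty) :
    minval v T ≤ minval v S := by
  rw [minval, minval, dif_pos hS, dif_pos (hS.mono hST)]
  exact Finset.inf'_mono v hST hS

lemma exists_mem_eq_minval (hS : S.Nonempty) : ∃ g ∈ S, v g = minval v S := by
  obtain ⟨g, hg, h⟩ := Finset.exists_mem_eq_inf' hS v
  exact ⟨g, hg, by rw [minval, dif_pos hS, h]⟩

lemma val_eq_minval_of_card_le_one (hS : S.card ≤ 1) : val v S = minval v S := by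
  rcases S.eq_empty_or_nonempty with rfl | h
  · simp [_root_.val, minval]
  · obtain ⟨g, rfl⟩ := Finset.card_eq_one.1 (le_antisymm hS h.card_pos)
    simp [_root_.val, minval]

lemma val_nonneg (hv : ∀ g, 0 ≤ v g) (S : Finset G) : 0 ≤ val v S :=
  Finset.sum_nonneg fun g _ => hv g

lemma val_erase_of_mem {g : G} (hg : g ∈ S) : val v (S.erase g) = val v S - v g := by
  rw [_root_.val, _root_.val, ← Finset.add_sum_erase S v hg]
  ring

end Minval

/-- A self-map of a finite type preserving a nonempty set `S` can be followed on its periodic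
points in `S`, and ignored elsewhere, to give an injective self-map. -/
lemma exists_injective_eq_self_or_eq {ι : Type*} [Finite ι] {S : Set ι} (hS : S.Nonempty)
    {σ : ι → ι} (hσ : Set.MapsTo σ S S) :
    ∃ τ : ι → ι, Function.Injective τ ∧ (∀ i, τ i = i ∨ i ∈ S ∧ τ i = σ i) ∧
      ∃ i ∈ S, τ i = σ i := by
  obtain ⟨x, hx⟩ := hS
  set P : Set ι := Function.periodicPts σ ∩ S
  have hmaps : Set.MapsTo σ P P := fun i hi =>
    ⟨(Function.bijOn_periodicPts σ).mapsTo hi.1, hσ hi.2⟩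
  have hinj : Set.InjOn σ P := (Function.bijOn_periodicPts σ).injOn.mono Set.inter_subset_left
  have hne : ∃ i, i ∈ P := by
    obtain ⟨a, b, hab, h⟩ := Finite.exists_ne_map_eq_of_infinite fun k : ℕ => σ^[k] x
    wlog hlt : a < b generalizing a b
    · exact this b a hab.symm h.symm (lt_of_le_of_ne (not_lt.1 hlt) hab.symm)
    refine ⟨σ^[a] x, Function.mk_mem_periodicPts (n := b - a) (by omega) ?_, hσ.iterate a hx⟩
    rw [Function.IsPeriodicPt, Function.IsFixedPt, ← Function.iterate_add_apply,
      Nat.sub_add_cancel hlt.le]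
    exact h.symm
  refine ⟨fun i => if i ∈ P then σ i else i, ?_, fun i => ?_, ?_⟩
  · intro i j hij
    by_cases hi : i ∈ P <;> by_cases hj : j ∈ P <;> simp only [hi, hj, if_true, if_false] at hij
    · exact hinj hi hj hij
    · exact absurd (hij ▸ hmaps hi) hj
    · exact absurd (hij ▸ hmaps hj) hi
    · exact hij
  · by_cases hi : i ∈ P
    · exact Or.inr ⟨hi.2, if_pos hi⟩
    · exact Or.inl (if_neg hi)
  · obtain ⟨i, hi⟩ := hne
    exact ⟨i, hi.2, if_pos hi⟩

section Matching

variable {G : Type*} {n : ℕ} {v : Fin n → G → ℝ} {X : Fin n → Finset G} {r u : Fin n}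

lemma card_inV1 : Fintype.card {i : Fin n // InV1 i} = n - 1 := by
  have h : Fintype.card {i : Fin n // InV1 i} = min n (n - 1) := by
    rw [Fintype.card_subtype, ← Fin.card_filter_val_lt]
    simp only [InV1]
    congr
  omega

/-- An injection along edges from `V₁` into `V₂ \ {u}` is a perfect matching of `G_X - u`. -/
lemma exists_isPM_of_injective (F : {i : Fin n // InV1 i} → Fin n)
    (hF : Function.Injective F) (hu : ∀ i, F i ≠ u) (hE : ∀ i, Edge v X r i.1 (F i)) :
    ∃ f, IsPM v X r u f := by
  have himg : Finset.univ.image F = Finset.univ.erase u := by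
    apply Finset.eq_of_subset_of_card_le
    · intro w hw
      obtain ⟨i, -, rfl⟩ := Finset.mem_image.1 hw
      exact Finset.mem_erase.2 ⟨hu i, Finset.mem_univ _⟩
    · rw [Finset.card_image_of_injective _ hF, Finset.card_univ, card_inV1,
        Finset.card_erase_of_mem (Finset.mem_univ _), Finset.card_univ, Fintype.card_fin]
  have hval : ∀ i (hi : InV1 i), (if h : InV1 i then F ⟨i, h⟩ else u) = F ⟨i, hi⟩ :=
    fun i hi => dif_pos hi
  refine ⟨fun i => if h : InV1 i then F ⟨i, h⟩ else u, ?_, ?_, ?_⟩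
  · intro i hi j hj hij
    have hij' : F ⟨i, hi⟩ = F ⟨j, hj⟩ := by rw [← hval i hi, ← hval j hj]; exact hij
    exact congrArg Subtype.val (hF hij')
  · intro i hi
    simp only [hval i hi]
    exact ⟨hu _, hE _⟩
  · intro w hw
    have hw' : w ∈ Finset.univ.image F := himg ▸ Finset.mem_erase.2 ⟨hw, Finset.mem_univ _⟩
    obtain ⟨⟨i, hi⟩, -, rfl⟩ := Finset.mem_image.1 hw'
    exact ⟨i, hi, hval i hi⟩

/-- If `F` is a perfect matching of `G_X - r` and `G_X - u` has none, then some nonempty set of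
agents has all its neighbors among its own partners under `F`. -/
lemma exists_nonempty_edge_mem_image (F : {i : Fin n // InV1 i} → Fin n)
    (hF : Function.Injective F) (hE : ∀ i, Edge v X r i.1 (F i))
    (hu : ¬ ∃ f, IsPM v X r u f) :
    ∃ S : Finset {i : Fin n // InV1 i}, S.Nonempty ∧
      ∀ i ∈ S, ∀ w, Edge v X r i.1 w → w ∈ S.image F := by
  have hHall : ¬ ∀ S : Finset {i : Fin n // InV1 i}, S.card ≤
      (S.biUnion fun i => Finset.univ.filter fun w => w ≠ u ∧ Edge v X r i.1 w).card := by
    intro h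
    obtain ⟨F', hF', hmem⟩ := (Finset.all_card_le_biUnion_card_iff_exists_injective _).1 h
    simp only [Finset.mem_filter, Finset.mem_univ, true_and] at hmem
    exact hu (exists_isPM_of_injective F' hF' (fun i => (hmem i).1) fun i => (hmem i).2)
  push Not at hHall
  obtain ⟨S, hS⟩ := hHall
  refine ⟨S, ?_, ?_⟩
  · by_contra h
    simp [Finset.not_nonempty_iff_eq_empty.1 h] at hS
  set B := S.biUnion fun i => Finset.univ.filter fun w => w ≠ u ∧ Edge v X r i.1 w
  have hmemB : ∀ w, (∃ i ∈ S, Edge v X r i.1 w) → w ∈ insert u B := by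
    rintro w ⟨i, hi, hw⟩
    by_cases h : w = u
    · simp [h]
    · exact Finset.mem_insert_of_mem
        (Finset.mem_biUnion.2 ⟨i, hi, by simp [h, hw]⟩)
  have hsub : S.image F ⊆ insert u B := by
    intro w hw
    obtain ⟨i, hi, rfl⟩ := Finset.mem_image.1 hw
    exact hmemB _ ⟨i, hi, hE i⟩
  have heq : S.image F = insert u B := by
    apply Finset.eq_of_subset_of_card_le hsub
    rw [Finset.card_image_of_injective _ hF]
    exact (Finset.card_insert_le _ _).trans hS
  intro i hi w hw
  rw [heq]
  exact hmemB w ⟨i, hi, hw⟩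

end Matching

section Averaging

variable {G : Type*} {n : ℕ} {v : Fin n → G → ℝ} {X : Fin n → Finset G} {r i : Fin n}

lemma sum_erase_erase_le (hv : ∀ g, 0 ≤ v i g) (u : Fin n) :
    ∑ u' ∈ (Finset.univ.erase r).erase u, minval (v i) (X u') ≤
      ∑ u' ∈ Finset.univ.erase r, minval (v i) (X u') :=
  Finset.sum_le_sum_of_subset_of_nonneg (Finset.erase_subset _ _)
    fun _ _ _ => minval_nonneg hv _

lemma sum_sum_erase_erase (m : Fin n → ℝ) (r : Fin n) :
    ∑ u, ∑ u' ∈ (Finset.univ.erase r).erase u, m u' =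
      ((n : ℝ) - 1) * ∑ u' ∈ Finset.univ.erase r, m u' := by
  have h : ∀ u, ∑ u' ∈ (Finset.univ.erase r).erase u, m u' =
      ∑ u' ∈ Finset.univ.erase r, m u' - if u ∈ Finset.univ.erase r then m u else 0 := by
    intro u
    split_ifs with hu
    · rw [← Finset.add_sum_erase _ m hu]; ring
    · rw [Finset.erase_eq_of_notMem hu, sub_zero]
  simp_rw [h]
  rw [Finset.sum_sub_distrib, Finset.sum_ite_mem, Finset.univ_inter, Finset.sum_const,
    Finset.card_univ, Fintype.card_fin, nsmul_eq_mul]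
  ring

lemma IsAlloc.sum_val [Fintype G] (hX : IsAlloc X) (w : G → ℝ) :
    ∑ u, val w (X u) = val w Finset.univ := by
  have hU : (Finset.univ : Finset G) = Finset.univ.biUnion X := by
    ext g
    simpa using hX.2 g
  rw [hU, _root_.val, Finset.sum_biUnion fun a _ b _ hab => hX.1 a b hab]
  rfl

/-- An agent whose neighbors all lie in `W ∌ r` still accepts some bundle of `W` after losing
its least valued good. -/
lemma exists_mem_lt_sub_minval [Fintype G] (hn : 2 ≤ n) (hX : IsAlloc X)
    (hv : ∀ g, 0 ≤ v i g) (hnorm : val (v i) Finset.univ = 1) {W : Finset (Fin n)}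
    (hr : r ∉ W) (hW : ∀ u, Edge v X r i u → u ∈ W) :
    ∃ u ∈ W, 1 / (n : ℝ) < val (v i) (X u) - minval (v i) (X u) + (1 / ((n : ℝ) - 1)) *
      ∑ u' ∈ (Finset.univ.erase r).erase u, minval (v i) (X u') := by
  by_contra! hcon
  have hn' : (2 : ℝ) ≤ n := by exact_mod_cast hn
  have hc : (n : ℝ) - 1 ≠ 0 := by linarith
  set m : Fin n → ℝ := fun u => minval (v i) (X u)
  set a : Fin n → ℝ := fun u => ∑ u' ∈ (Finset.univ.erase r).erase u, m u'
  set M : ℝ := ∑ u' ∈ Finset.univ.erase r, m u'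
  have hlt : ∑ u, (val (v i) (X u) - (if u ∈ W then m u else 0) + (1 / ((n : ℝ) - 1)) * a u) <
      ∑ _u : Fin n, 1 / (n : ℝ) := by
    have hout : ∀ u, u ∉ W → val (v i) (X u) - (if u ∈ W then m u else 0) +
        (1 / ((n : ℝ) - 1)) * a u < 1 / (n : ℝ) := by
      intro u hu
      rw [if_neg hu, sub_zero]
      exact not_le.1 fun h => hu (hW u h)
    refine Finset.sum_lt_sum (fun u _ => ?_) ⟨r, Finset.mem_univ _, hout r hr⟩
    by_cases hu : u ∈ W
    · rw [if_pos hu]; exact hcon u hu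
    · exact (hout u hu).le
  rw [Finset.sum_add_distrib, Finset.sum_sub_distrib, hX.sum_val, hnorm, ← Finset.mul_sum,
    sum_sum_erase_erase m r, Finset.sum_ite_mem, Finset.univ_inter, Finset.sum_const,
    Finset.card_univ, Fintype.card_fin, nsmul_eq_mul, mul_one_div_cancel (by linarith),
    ← mul_assoc, one_div_mul_cancel hc, one_mul] at hlt
  have hWM : ∑ u ∈ W, m u ≤ M :=
    Finset.sum_le_sum_of_subset_of_nonneg
      (fun u hu => Finset.mem_erase.2 ⟨fun h => hr (h ▸ hu), Finset.mem_univ _⟩)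
      fun _ _ _ => minval_nonneg hv _
  linarith

lemma one_lt_card_of_lt_sub_minval (hn : 2 ≤ n) (hv : ∀ g, 0 ≤ v i g)
    (hr : ¬ Edge v X r i r) {u : Fin n}
    (hu : 1 / (n : ℝ) < val (v i) (X u) - minval (v i) (X u) + (1 / ((n : ℝ) - 1)) *
      ∑ u' ∈ (Finset.univ.erase r).erase u, minval (v i) (X u')) :
    1 < (X u).card := by
  by_contra! hcard
  have hn' : (2 : ℝ) ≤ n := by exact_mod_cast hn
  rw [val_eq_minval_of_card_le_one hcard, sub_self, zero_add] at hu
  rw [Edge, Finset.erase_eq_of_notMem (Finset.notMem_erase r _), ge_iff_le, not_le] at hr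
  have hle := mul_le_mul_of_nonneg_left (sum_erase_erase_le (X := X) (r := r) hv u)
    (by apply one_div_nonneg.2; linarith : 0 ≤ 1 / ((n : ℝ) - 1))
  have := val_nonneg hv (X r)
  linarith

end Averaging

section Move

variable {G : Type*} {n : ℕ} {v : Fin n → G → ℝ} {X : Fin n → Finset G} {r u : Fin n} {g : G}

lemma move_self : move X r u g r = insert g (X r) := if_pos rfl

lemma move_source (hur : u ≠ r) : move X r u g u = (X u).erase g := by
  rw [move, if_neg hur, if_pos rfl]

lemma move_of_ne {w : Fin n} (hwr : w ≠ r) (hwu : w ≠ u) : move X r u g w = X w := by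
  rw [move, if_neg hwr, if_neg hwu]

lemma IsAlloc.move (hX : IsAlloc X) (hur : u ≠ r) (hg : g ∈ X u) :
    IsAlloc (move X r u g) := by
  have huniq : ∀ {x a b}, x ∈ X a → x ∈ X b → a = b := fun {x a b} ha hb => by
    by_contra hab
    exact Finset.disjoint_left.1 (hX.1 a b hab) ha hb
  have hmem : ∀ x w, x ∈ _root_.move X r u g w ↔
      (x = g ∧ w = r) ∨ (x ≠ g ∧ x ∈ X w) := by
    intro x w
    by_cases hwr : w = r
    · subst hwr
      rw [move_self, Finset.mem_insert]
      tauto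
    · by_cases hwu : w = u
      · subst hwu
        rw [move_source hwr, Finset.mem_erase]
        tauto
      · rw [move_of_ne hwr hwu]
        have : x ∈ X w → x ≠ g := fun hx h => hwu (huniq hx (h ▸ hg))
        tauto
  constructor
  · intro a b hab
    rw [Finset.disjoint_left]
    intro x hxa hxb
    rw [hmem] at hxa hxb
    rcases hxa with ⟨h1, h2⟩ | ⟨h1, h2⟩ <;> rcases hxb with ⟨h3, h4⟩ | ⟨h3, h4⟩
    · exact hab (h2.trans h4.symm)
    · exact h3 h1
    · exact h1 h3
    · exact hab (huniq h2 h4)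
  · intro x
    by_cases hx : x = g
    · exact ⟨r, (hmem x r).2 (Or.inl ⟨hx, rfl⟩)⟩
    · obtain ⟨w, hw⟩ := hX.2 x
      exact ⟨w, (hmem x w).2 (Or.inr ⟨hx, hw⟩)⟩

lemma Edge.move_of_ne {i w : Fin n} (hn : 2 ≤ n) (hE : Edge v X r i w) (hg : g ∈ X u)
    (hcard : 1 < (X u).card) (hwr : w ≠ r) (hwu : w ≠ u) :
    Edge v (move X r u g) r i w := by
  have hn' : (2 : ℝ) ≤ n := by exact_mod_cast hn
  rw [Edge, _root_.move_of_ne hwr hwu]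
  refine le_trans hE ?_
  gcongr with w' hw'
  · apply one_div_nonneg.2; linarith
  · have hw'r : w' ≠ r := (Finset.mem_erase.1 (Finset.mem_erase.1 hw').2).1
    by_cases h : w' = u
    · subst h
      rw [move_source hw'r]
      refine minval_le_minval_of_subset (Finset.erase_subset _ _) ?_
      rw [← Finset.card_pos, Finset.card_erase_of_mem hg]
      omega
    · rw [_root_.move_of_ne hw'r h]

lemma edge_move_source {i : Fin n} (hur : u ≠ r) (hg : g ∈ X u)
    (hE : 1 / (n : ℝ) ≤ val (v i) (X u) - v i g + (1 / ((n : ℝ) - 1)) *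
      ∑ u' ∈ (Finset.univ.erase r).erase u, minval (v i) (X u')) :
    Edge v (move X r u g) r i u := by
  rw [Edge, move_source hur, val_erase_of_mem hg]
  refine le_trans hE (le_of_eq ?_)
  congr 2
  refine Finset.sum_congr rfl fun w hw => ?_
  obtain ⟨hwu, hw⟩ := Finset.mem_erase.1 hw
  rw [_root_.move_of_ne (Finset.mem_erase.1 hw).1 hwu]

end Move

/-- Proposition 1: if `X` satisfies (P1) but not (P2), there is another
allocation `X'` to `V₂` satisfying (P1) with `|X'_r| = |X_r| + 1`. -/
theorem update_step {G : Type*} [Fintype G] (n : ℕ) (hn : 2 ≤ n)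
    (v : Fin n → G → ℝ) (X : Fin n → Finset G) (r : Fin n)
    (hpos : ∀ (i : Fin n) (g : G), 0 ≤ v i g)
    (hnorm : ∀ i : Fin n, val (v i) (Finset.univ : Finset G) = 1)
    (hX : IsAlloc X)
    (hP1 : P1 v X r) (hnP2 : ¬ P2 v X r) :
    ∃ X' : Fin n → Finset G, IsAlloc X' ∧ P1 v X' r ∧ (X' r).card = (X r).card + 1 := by
  obtain ⟨f, hfinj, hfE, -⟩ := hP1
  obtain ⟨u₀, hu₀⟩ := not_forall.1 hnP2
  set F : {i : Fin n // InV1 i} → Fin n := fun i => f i.1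
  have hF : Function.Injective F := fun i j hij => Subtype.ext (hfinj i.2 j.2 hij)
  have hFr : ∀ i, F i ≠ r := fun i => (hfE i.1 i.2).1
  have hFE : ∀ i, Edge v X r i.1 (F i) := fun i => (hfE i.1 i.2).2
  obtain ⟨S, hS, hSW⟩ := exists_nonempty_edge_mem_image F hF hFE hu₀
  have hrW : r ∉ S.image F := by simp [hFr]
  have hstrong : ∀ i, ∃ j, i ∈ S → j ∈ S ∧
      1 / (n : ℝ) < val (v i.1) (X (F j)) - minval (v i.1) (X (F j)) + (1 / ((n : ℝ) - 1)) *
        ∑ u' ∈ (Finset.univ.erase r).erase (F j), minval (v i.1) (X u') := by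
    intro i
    by_cases hi : i ∈ S
    · obtain ⟨u, hu, h⟩ :=
        exists_mem_lt_sub_minval hn hX (hpos i.1) (hnorm i.1) hrW (hSW i hi)
      obtain ⟨j, hj, rfl⟩ := Finset.mem_image.1 hu
      exact ⟨j, fun _ => ⟨hj, h⟩⟩
    · exact ⟨i, fun h => absurd h hi⟩
  choose σ hσ using hstrong
  obtain ⟨τ, hτ, hτσ, i₀, hi₀, hτi₀⟩ := exists_injective_eq_self_or_eq
    (S := (S : Set {i : Fin n // InV1 i})) (by simpa using hS)
    (σ := σ) (fun i hi => (hσ i hi).1)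
  have hτE : ∀ i, Edge v X r i.1 (F (τ i)) := by
    intro i
    rcases hτσ i with h | ⟨hi, h⟩
    · rw [h]; exact hFE i
    · rw [h, Edge]
      have h1 := (hσ i hi).2
      have h2 := minval_nonneg (hpos i.1) (X (F (σ i)))
      linarith
  have hlt := (hσ i₀ hi₀).2
  rw [← hτi₀] at hlt
  set u := F (τ i₀)
  have hur : u ≠ r := hFr _
  have hcard : 1 < (X u).card :=
    one_lt_card_of_lt_sub_minval hn (hpos i₀.1) (fun h => hrW (hSW i₀ hi₀ r h)) hlt
  obtain ⟨g, hg, hgmin⟩ := exists_mem_eq_minval (v := v i₀.1)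
    (Finset.card_pos.1 (Nat.zero_lt_of_lt hcard))
  refine ⟨move X r u g, hX.move hur hg,
    exists_isPM_of_injective (F ∘ τ) (hF.comp hτ) (fun i => hFr _) fun i => ?_, ?_⟩
  · by_cases hi : i = i₀
    · subst hi
      refine edge_move_source hur hg ?_
      rw [hgmin]
      exact hlt.le
    · exact (hτE i).move_of_ne hn hg hcard (hFr _) fun h => hi (hτ (hF h))
  · rw [move_self, Finset.card_insert_of_notMem]
    exact Finset.disjoint_left.1 (hX.1 u r hur) hg
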